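/- arXiv:1602.05487 — 3 statements merged into one kernel-verified Lean document; each statement's English description precedes it below -/
import Mathlib

section
/- Let (X,d) be a metric space, I ⊂ ℝ a nonempty interval, and γ : I → X a piecewise locally Lipschitz curve (i.e. there exist t_0 = inf I < t_1 < … < t_n = sup I such that γ is continuous on I and locally Lipschitz on I ∩ (t_i, t_{i+1}) for each i). Then for almost every t ∈ I the metric derivative |γ̇|(t) := lim_{s→t} d(γ(t),γ(s))/|t−s| exists, and the function t ↦ |γ̇|(t) (defined a.e.) is measurable. -/
open Filter Topology MeasureTheory Set
open scoped ENNReal NNReal Classical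

section Defs

variable {X : Type*} [MetricSpace X]

/-- The metric derivative of the curve `γ` within the set `I` at the point `t` exists and has
value `L`, i.e. `lim_{s → t, s ∈ I} dist (γ s) (γ t) / |s - t| = L`. -/
def HasMetricDerivWithinAt (γ : ℝ → X) (I : Set ℝ) (t : ℝ) (L : ℝ) : Prop :=
  Tendsto (fun s => dist (γ s) (γ t) / |s - t|) (𝓝[I \ {t}] t) (𝓝 L)

/-- The metric derivative `|γ̇|(t)` of `γ` within `I` at `t` (junk value `0` if the defining
limit does not exist). -/
noncomputable def metricDerivWithin (γ : ℝ → X) (I : Set ℝ) (t : ℝ) : ℝ :=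
  if h : ∃ L, HasMetricDerivWithinAt γ I t L then h.choose else 0

/-- `γ` is locally Lipschitz on the set `s ⊆ ℝ`. -/
def LocallyLipschitzOnSet (γ : ℝ → X) (s : Set ℝ) : Prop :=
  ∀ t ∈ s, ∃ ε > 0, ∃ C : NNReal, LipschitzOnWith C γ (s ∩ Metric.ball t ε)

/-- `γ` is a piecewise locally Lipschitz curve on the interval `I`: it is continuous on `I`
and locally Lipschitz outside finitely many points of `I` (equivalently, there are
`t_0 = inf I < t_1 < ⋯ < t_n = sup I` such that `γ` is locally Lipschitz on each
`I ∩ (t_i, t_(i+1))`). -/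
def PiecewiseLocLipOn (γ : ℝ → X) (I : Set ℝ) : Prop :=
  ContinuousOn γ I ∧ ∃ S : Finset ℝ, LocallyLipschitzOnSet γ (I \ ↑S)

/-- The `K`-weighted length `L_K(γ) = ∫_I K (γ t) * |γ̇| t dt` of a curve `γ` defined on `I`. -/
noncomputable def KLength (K : X → ℝ) (γ : ℝ → X) (I : Set ℝ) : ℝ≥0∞ :=
  ∫⁻ t in I, ENNReal.ofReal (K (γ t) * metricDerivWithin γ I t)

/-- The filter of approach to the left endpoint of the interval `I` (the endpoint may be
`-∞`, i.e. `I` may be unbounded below). -/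
noncomputable def leftEndFilter (I : Set ℝ) : Filter ℝ :=
  if BddBelow I then 𝓝[I] (sInf I) else Filter.atBot ⊓ Filter.principal I

/-- The filter of approach to the right endpoint of the interval `I`. -/
noncomputable def rightEndFilter (I : Set ℝ) : Filter ℝ :=
  if BddAbove I then 𝓝[I] (sSup I) else Filter.atTop ⊓ Filter.principal I

/-- `γ`, defined on the nonempty interval `I`, is a path from `x` to `y`: it is continuous on
`I` and converges to `x` (resp. `y`) at the left (resp. right) endpoint of `I` (where the
value at an infinite endpoint is understood as a limit). -/
def IsPathOn (γ : ℝ → X) (I : Set ℝ) (x y : X) : Prop :=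
  I.Nonempty ∧ I.OrdConnected ∧ ContinuousOn γ I ∧
    Tendsto γ (leftEndFilter I) (𝓝 x) ∧ Tendsto γ (rightEndFilter I) (𝓝 y)

/-- The weighted (pseudo-)distance `d_K(x,y)`: the infimum of `L_K` over piecewise locally
Lipschitz paths from `x` to `y`. -/
noncomputable def dK (K : X → ℝ) (x y : X) : ℝ≥0∞ :=
  ⨅ (γ : ℝ → X) (I : Set ℝ) (_ : PiecewiseLocLipOn γ I) (_ : IsPathOn γ I x y),
    KLength K γ I

/-- The intrinsic (geodesic) distance: the infimum of the length `L_d(γ) = eVariationOn γ I`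
over all paths from `x` to `y`. -/
noncomputable def geodDist (x y : X) : ℝ≥0∞ :=
  ⨅ (γ : ℝ → X) (I : Set ℝ) (_ : IsPathOn γ I x y), eVariationOn γ I

/-- A length space: the distance coincides with the intrinsic distance. -/
def IsLengthSpace (Y : Type*) [MetricSpace Y] : Prop :=
  ∀ x y : Y, geodDist x y = edist x y

/-- `K_r(x) := inf { K z : dist x z ≤ r }`. -/
noncomputable def Kinf (K : X → ℝ) (x : X) (r : ℝ) : ℝ :=
  sInf (K '' Metric.closedBall x r)

/-- `K^r(x) := sup { K z : dist x z ≤ r }`. -/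
noncomputable def Ksup (K : X → ℝ) (x : X) (r : ℝ) : ℝ :=
  sSup (K '' Metric.closedBall x r)

/-- The energy `E_W(γ) = ∫_I (½ |γ̇|(t)² + W (γ t)) dt`. -/
noncomputable def energyW (W : X → ℝ) (γ : ℝ → X) (I : Set ℝ) : ℝ≥0∞ :=
  ∫⁻ t in I, ENNReal.ofReal ((metricDerivWithin γ I t) ^ 2 / 2 + W (γ t))

end Defs

section MetricDerivative

variable {X : Type*} [MetricSpace X]

theorem HasDerivAt.tendsto_abs_sub_div {f : ℝ → ℝ} {f' t : ℝ} (h : HasDerivAt f f' t) :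
    Tendsto (fun s => |f s - f t| / |s - t|) (𝓝[≠] t) (𝓝 |f'|) := by
  refine h.tendsto_slope.abs.congr fun s => ?_
  rw [slope_def_field, abs_div]

theorem LipschitzWith.abs_sub_le_integral_of_abs_deriv_le {f m : ℝ → ℝ} {C : ℝ≥0}
    (hf : LipschitzWith C f) (hm : LocallyIntegrable m) (hle : ∀ t, |deriv f t| ≤ m t) (s t : ℝ) :
    |f s - f t| ≤ |∫ x in t..s, m x| := by
  have hac : AbsolutelyContinuousOnInterval f t s :=
    (hf.lipschitzOnWith (s := uIcc t s)).absolutelyContinuousOnInterval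
  have hmi : IntervalIntegrable m volume t s := intervalIntegrable_iff.2
    ((hm.integrableOn_isCompact isCompact_uIcc).mono_set uIoc_subset_uIcc)
  rw [← hac.integral_deriv_eq_sub]
  exact intervalIntegral.norm_integral_le_abs_of_norm_le (f := deriv f)
    (Eventually.of_forall hle) hmi

/-- A Lipschitz curve in a metric space has a metric derivative at almost every time. -/
theorem LipschitzWith.ae_exists_metricDeriv {γ : ℝ → X} {C : ℝ≥0} (hγ : LipschitzWith C γ) :
    ∀ᵐ t, ∃ L, Tendsto (fun s => dist (γ s) (γ t) / |s - t|) (𝓝[≠] t) (𝓝 L) := by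
  let f : ℚ → ℝ → ℝ := fun q s => dist (γ s) (γ q)
  have hf (q : ℚ) : LipschitzWith C (f q) := by
    simpa [f, Function.comp_def] using (LipschitzWith.dist_left (γ q)).comp hγ
  let m : ℝ → ℝ := fun t => ⨆ q, |deriv (f q) t|
  have hbound (q : ℚ) (t : ℝ) : |deriv (f q) t| ≤ C := norm_deriv_le_of_lipschitz (hf q)
  have hbdd (t : ℝ) : BddAbove (range fun q => |deriv (f q) t|) :=
    ⟨C, by rintro _ ⟨q, rfl⟩; exact hbound q t⟩
  have hle (q : ℚ) (t : ℝ) : |deriv (f q) t| ≤ m t := le_ciSup (hbdd t) q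
  have hm0 (t : ℝ) : 0 ≤ m t := (abs_nonneg _).trans (hle 0 t)
  have hmeas : Measurable m := Measurable.iSup fun q => (measurable_deriv (f q)).abs
  have hloc : LocallyIntegrable m := by
    refine (locallyIntegrable_const (C : ℝ)).mono hmeas.aestronglyMeasurable
      (Eventually.of_forall fun t => ?_)
    rw [Real.norm_of_nonneg (hm0 t), Real.norm_of_nonneg C.coe_nonneg]
    exact ciSup_le fun q => hbound q t
  have hdist (s t : ℝ) : dist (γ s) (γ t) ≤ |∫ x in t..s, m x| := by
    have key (r : ℝ) : dist (γ s) (γ r) - dist (γ t) (γ r) ≤ |∫ x in t..s, m x| := by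
      refine Rat.denseRange_cast.induction_on r ?_ fun q => ?_
      · have := hγ.continuous
        exact isClosed_le (by fun_prop) continuous_const
      · exact (le_abs_self _).trans
          ((hf q).abs_sub_le_integral_of_abs_deriv_le hloc (hle q) s t)
    simpa using key t
  have hdiff : ∀ᵐ t, ∀ q, DifferentiableAt ℝ (f q) t :=
    ae_all_iff.2 fun q => (hf q).ae_differentiableAt_real
  filter_upwards [hdiff, LocallyIntegrable.ae_hasDerivAt_integral hloc] with t ht hG
  refine ⟨m t, tendsto_order.2 ⟨fun a ha => ?_, fun a ha => ?_⟩⟩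
  · obtain ⟨q, hq⟩ := exists_lt_of_lt_ciSup ha
    filter_upwards [(ht q).hasDerivAt.tendsto_abs_sub_div.eventually_const_lt hq] with s hs
    refine hs.trans_le ?_
    gcongr
    exact abs_dist_sub_le _ _ _
  · have hlim := (hG t).tendsto_abs_sub_div
    rw [abs_of_nonneg (hm0 t)] at hlim
    filter_upwards [hlim.eventually_lt_const ha] with s hs
    refine lt_of_le_of_lt ?_ hs
    gcongr
    simpa using hdist s t

theorem LipschitzOnWith.ae_exists_metricDeriv_of_mem_Ioo {γ : ℝ → X} {C : ℝ≥0} {a b : ℝ}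
    (hγ : LipschitzOnWith C γ (Icc a b)) :
    ∀ᵐ t, t ∈ Ioo a b →
      ∃ L, Tendsto (fun s => dist (γ s) (γ t) / |s - t|) (𝓝[≠] t) (𝓝 L) := by
  rcases lt_or_ge a b with hab | hab
  · have hext : LipschitzWith (C * 1) (IccExtend hab.le ((Icc a b).domRestrict γ)) :=
      hγ.to_restrict.comp (LipschitzWith.projIcc hab.le)
    filter_upwards [hext.ae_exists_metricDeriv] with t ⟨L, hL⟩ ht
    refine ⟨L, hL.congr' ?_⟩
    filter_upwards [nhdsWithin_le_nhds (Ioo_mem_nhds ht.1 ht.2)] with s hs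
    rw [IccExtend_of_mem _ _ (Ioo_subset_Icc_self hs),
      IccExtend_of_mem _ _ (Ioo_subset_Icc_self ht)]
    rfl
  · simp [Ioo_eq_empty hab.not_gt]

theorem LocallyLipschitzOnSet.ae_exists_metricDeriv {γ : ℝ → X} {U : Set ℝ} (hU : IsOpen U)
    (hγ : LocallyLipschitzOnSet γ U) :
    ∀ᵐ t, t ∈ U → ∃ L, Tendsto (fun s => dist (γ s) (γ t) / |s - t|) (𝓝[≠] t) (𝓝 L) := by
  rw [ae_iff]
  refine measure_null_of_locally_null _ fun t ht => ?_
  have htU : t ∈ U := by by_contra h; exact ht fun h' => absurd h' h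
  obtain ⟨ε, hε, C, hC⟩ := hγ t htU
  obtain ⟨δ, hδ, hball⟩ := Metric.isOpen_iff.1 hU t htU
  obtain ⟨r, hr, hrlt⟩ := exists_between (lt_min hε hδ)
  have hsub : Icc (t - r) (t + r) ⊆ U ∩ Metric.ball t ε := by
    rw [← Real.closedBall_eq_Icc]
    exact subset_inter
      ((Metric.closedBall_subset_ball (hrlt.trans_le (min_le_right _ _))).trans hball)
      (Metric.closedBall_subset_ball (hrlt.trans_le (min_le_left _ _)))
  refine ⟨_, inter_mem self_mem_nhdsWithin (nhdsWithin_le_nhds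
    (Ioo_mem_nhds (sub_lt_self t hr) (lt_add_of_pos_right t hr))), ?_⟩
  refine measure_mono_null ?_ (ae_iff.1 (hC.mono hsub).ae_exists_metricDeriv_of_mem_Ioo)
  rintro s ⟨hs, hsI⟩ h
  exact hs fun _ => h hsI

theorem LocallyLipschitzOnSet.mono {γ : ℝ → X} {s u : Set ℝ} (hγ : LocallyLipschitzOnSet γ s)
    (hus : u ⊆ s) : LocallyLipschitzOnSet γ u := fun t ht =>
  let ⟨ε, hε, C, hC⟩ := hγ t (hus ht)
  ⟨ε, hε, C, hC.mono (inter_subset_inter_left _ hus)⟩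

theorem HasMetricDerivWithinAt.metricDerivWithin_of_exists {γ : ℝ → X} {I : Set ℝ} {t : ℝ}
    (h : ∃ L, HasMetricDerivWithinAt γ I t L) :
    HasMetricDerivWithinAt γ I t (metricDerivWithin γ I t) := by
  rw [metricDerivWithin, dif_pos h]
  exact h.choose_spec

theorem Set.OrdConnected.ae_restrict_mem_interior {I : Set ℝ} (hI : I.OrdConnected) :
    ∀ᵐ t ∂(volume.restrict I), t ∈ interior I := by
  rw [ae_restrict_iff' hI.measurableSet]
  filter_upwards [compl_mem_ae_iff.2 (hI.convex.addHaar_frontier volume)] with t ht htI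
  by_contra h
  exact ht ⟨subset_closure htI, h⟩

/-- The forward difference quotients of a curve, set to zero where they leave `I`, are measurable
and converge to the metric derivative in the interior of `I`. -/
theorem aemeasurable_metricDerivWithin {γ : ℝ → X} {I : Set ℝ} (hI : I.OrdConnected)
    (hγ : ContinuousOn γ I)
    (hex : ∀ᵐ t ∂(volume.restrict I), ∃ L, HasMetricDerivWithinAt γ I t L) :
    AEMeasurable (metricDerivWithin γ I) (volume.restrict I) := by
  let u : ℕ → ℝ := fun n => 1 / ((n : ℝ) + 1)
  have hu0 (n : ℕ) : 0 < u n := Nat.one_div_pos_of_nat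
  have hu : Tendsto u atTop (𝓝 0) := tendsto_one_div_add_atTop_nhds_zero_nat
  let A : ℕ → Set ℝ := fun n => I ∩ (fun t => t + u n) ⁻¹' I
  have hA (n : ℕ) : MeasurableSet (A n) :=
    hI.measurableSet.inter (measurable_add_const (u n) hI.measurableSet)
  refine aemeasurable_of_tendsto_metrizable_ae'
    (f := fun n => (A n).indicator fun t => dist (γ (t + u n)) (γ t) / |t + u n - t|)
    (fun n => AEMeasurable.restrict ?_) ?_
  · rw [aemeasurable_indicator_iff (hA n)]
    refine ContinuousOn.aemeasurable ?_ (hA n)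
    have h1 : ContinuousOn (fun t => γ (t + u n)) (A n) :=
      hγ.comp (by fun_prop) fun t ht => ht.2
    have h2 : ContinuousOn γ (A n) := hγ.mono inter_subset_left
    simpa using (continuous_dist.comp_continuousOn (h1.prodMk h2)).div_const |u n|
  · filter_upwards [hex, hI.ae_restrict_mem_interior] with t ht htI
    have hlim : Tendsto (fun n => t + u n) atTop (𝓝 t) := by simpa using hu.const_add t
    have hmem : ∀ᶠ n in atTop, t + u n ∈ I := hlim (mem_interior_iff_mem_nhds.1 htI)
    have hwithin : Tendsto (fun n => t + u n) atTop (𝓝[I \ {t}] t) :=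
      tendsto_nhdsWithin_iff.2 ⟨hlim, hmem.mono fun n hn =>
        ⟨hn, by simpa using (hu0 n).ne'⟩⟩
    refine ((HasMetricDerivWithinAt.metricDerivWithin_of_exists ht).comp hwithin).congr' ?_
    filter_upwards [hmem] with n hn
    rw [indicator_of_mem (show t ∈ A n from ⟨interior_subset htI, hn⟩), Function.comp_apply]

end MetricDerivative

/-- For a piecewise locally Lipschitz curve `γ` on a nonempty interval `I`, the
metric derivative `|γ̇|(t)` exists for a.e. `t ∈ I`, and `t ↦ |γ̇|(t)` is (a.e.-)measurable. -/
theorem metricDeriv_exists_ae_and_measurable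
    {X : Type*} [MetricSpace X] (I : Set ℝ) (hne : I.Nonempty) (hint : I.OrdConnected)
    (γ : ℝ → X) (hγ : PiecewiseLocLipOn γ I) :
    (∀ᵐ t ∂(volume.restrict I), ∃ L, HasMetricDerivWithinAt γ I t L) ∧
      AEMeasurable (metricDerivWithin γ I) (volume.restrict I) := by
  have hex : ∀ᵐ t ∂(volume.restrict I), ∃ L, HasMetricDerivWithinAt γ I t L := by
    obtain ⟨S, hS⟩ := hγ.2
    have hlip : LocallyLipschitzOnSet γ (interior I \ ↑S) :=
      hS.mono (sdiff_subset_sdiff_left interior_subset)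
    have hopen : IsOpen (interior I \ ↑S) := isOpen_interior.sdiff S.finite_toSet.isClosed
    filter_upwards [ae_restrict_of_ae (hlip.ae_exists_metricDeriv hopen),
      hint.ae_restrict_mem_interior,
      ae_restrict_of_ae (compl_mem_ae_iff.2 (S.finite_toSet.measure_zero volume))]
      with t ht htI htS
    obtain ⟨L, hL⟩ := ht ⟨htI, htS⟩
    exact ⟨L, hL.mono_left (nhdsWithin_mono t fun s hs => hs.2)⟩
  exact ⟨hex, aemeasurable_metricDerivWithin hint hγ.1 hex⟩
end

section
/- Let (X,d) be a proper metric space, i.e. every closed bounded subset of X is compact. Let x⁻, x⁺ ∈ X be such that the intrinsic (geodesic) distance d_g(x⁻,x⁺) := inf{ L_d(γ) : γ a curve from x⁻ to x⁺ } is finite. Then there exists a curve γ : [a⁻, a⁺] → X with γ(a⁻) = x⁻, γ(a⁺) = x⁺ and L_d(γ) = d_g(x⁻,x⁺), i.e. a minimizing geodesic joining x⁻ and x⁺ exists. -/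
open Filter Topology MeasureTheory Set
open scoped ENNReal NNReal Classical

/-- The variation function of a continuous function of locally bounded variation is continuous. -/
theorem LocallyBoundedVariationOn.continuousOn_variationOnFromTo {X : Type*} [MetricSpace X]
    {γ : ℝ → X} {s : Set ℝ} (hγ : LocallyBoundedVariationOn γ s) (hc : ContinuousOn γ s)
    {a : ℝ} (ha : a ∈ s) : ContinuousOn (variationOnFromTo γ s a) s := by
  intro t ht
  have hleft := variationOnFromTo.tendsto_left ha ht hγ ((hc t ht).mono inter_subset_left)
  have hright := variationOnFromTo.tendsto_right ha ht hγ ((hc t ht).mono inter_subset_left)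
  rw [dist_self, sub_zero] at hleft
  rw [dist_self, add_zero] at hright
  refine continuousWithinAt_sdiff_self.mp ?_
  rw [show s \ {t} = s ∩ Iio t ∪ s ∩ Ioi t by
    rw [← inter_union_distrib_left, Iio_union_Ioi, sdiff_eq]]
  exact ContinuousWithinAt.union hleft hright

theorem LocallyBoundedVariationOn.dist_le_abs_variationOnFromTo {X : Type*} [MetricSpace X]
    {γ : ℝ → X} {s : Set ℝ} (hγ : LocallyBoundedVariationOn γ s) {t u : ℝ} (ht : t ∈ s)
    (hu : u ∈ s) : dist (γ t) (γ u) ≤ |variationOnFromTo γ s t u| := by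
  wlog htu : t ≤ u generalizing t u
  · rw [dist_comm, variationOnFromTo.eq_neg_swap, abs_neg]
    exact this hu ht (le_of_not_ge htu)
  rw [variationOnFromTo.eq_of_le _ _ htu, ENNReal.abs_toReal]
  exact BoundedVariationOn.dist_le (hγ t u ht hu) ⟨ht, left_mem_Icc.2 htu⟩
    ⟨hu, right_mem_Icc.2 htu⟩

/-- A continuous curve of length at most `C` admits a `C`-Lipschitz reparametrization by the unit
interval. -/
theorem ContinuousOn.exists_lipschitzOnWith_reparametrization {X : Type*} [MetricSpace X]
    {γ : ℝ → X} {a b : ℝ} (hab : a ≤ b) (hc : ContinuousOn γ (Icc a b)) {C : ℝ≥0}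
    (hC : eVariationOn γ (Icc a b) ≤ C) :
    ∃ g : ℝ → X, LipschitzOnWith C g (Icc 0 1) ∧ g 0 = γ a ∧ g 1 = γ b := by
  have hbv : BoundedVariationOn γ (Icc a b) := ne_top_of_le_ne_top ENNReal.coe_ne_top hC
  have hγ := hbv.locallyBoundedVariationOn
  have ha : a ∈ Icc a b := left_mem_Icc.2 hab
  have hb : b ∈ Icc a b := right_mem_Icc.2 hab
  set V := variationOnFromTo γ (Icc a b) a with hV
  have hVa : V a = 0 := variationOnFromTo.self _ _ _
  have hVb0 : 0 ≤ V b := variationOnFromTo.nonneg_of_le _ _ hab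
  have hVb : V b ≤ C := (le_abs_self _).trans <|
    (variationOnFromTo.abs_le_eVariationOn hbv).trans <|
      ENNReal.toReal_le_coe_of_le_coe hC
  have hdist : ∀ t ∈ Icc a b, ∀ u ∈ Icc a b, dist (γ t) (γ u) ≤ |V t - V u| := by
    intro t ht u hu
    rw [hV, variationOnFromTo.sub_right hγ ha ht hu, variationOnFromTo.eq_neg_swap, abs_neg]
    exact hγ.dist_le_abs_variationOnFromTo ht hu
  have hsurj : ∀ r ∈ Icc (0 : ℝ) 1, ∃ t ∈ Icc a b, V t = r * V b := by
    intro r hr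
    refine intermediate_value_Icc hab (hγ.continuousOn_variationOnFromTo hc ha) ?_
    change r * V b ∈ Icc (V a) (V b)
    rw [hVa]
    exact ⟨mul_nonneg hr.1 hVb0, mul_le_of_le_one_left hVb0 hr.2⟩
  choose! T hT hVT using hsurj
  have h0 : (0 : ℝ) ∈ Icc (0 : ℝ) 1 := left_mem_Icc.2 zero_le_one
  have h1 : (1 : ℝ) ∈ Icc (0 : ℝ) 1 := right_mem_Icc.2 zero_le_one
  refine ⟨γ ∘ T, LipschitzOnWith.of_dist_le_mul fun r hr r' hr' => ?_, ?_, ?_⟩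
  · refine (hdist _ (hT r hr) _ (hT r' hr')).trans ?_
    rw [hVT r hr, hVT r' hr', ← sub_mul, abs_mul, abs_of_nonneg hVb0, mul_comm, Real.dist_eq]
    gcongr
  · refine dist_le_zero.1 ((hdist _ (hT 0 h0) _ ha).trans ?_)
    simp [hVT 0 h0, hVa]
  · refine dist_le_zero.1 ((hdist _ (hT 1 h1) _ hb).trans ?_)
    simp [hVT 1 h1]

theorem IsPathOn.exists_le_dist_left_lt {X : Type*} [MetricSpace X] {γ : ℝ → X} {I : Set ℝ}
    {x y : X} (h : IsPathOn γ I x y) {c : ℝ} (hc : c ∈ I) {ε : ℝ} (hε : 0 < ε) :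
    ∃ a ∈ I, a ≤ c ∧ dist (γ a) x < ε := by
  have hev := h.2.2.2.1.eventually (Metric.ball_mem_nhds x hε)
  unfold leftEndFilter at hev
  split_ifs at hev with hI
  · rcases (csInf_le hI hc).eq_or_lt with heq | hlt
    · exact ⟨c, hc, le_rfl, (heq ▸ hev).self_of_nhdsWithin hc⟩
    · have : (𝓝[I] (sInf I)).NeBot :=
        mem_closure_iff_nhdsWithin_neBot.1 (csInf_mem_closure h.1 hI)
      obtain ⟨a, ⟨ha, haI⟩, hac⟩ := ((hev.and self_mem_nhdsWithin).and
        (mem_nhdsWithin_of_mem_nhds (Iio_mem_nhds hlt))).exists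
      exact ⟨a, haI, le_of_lt hac, ha⟩
  · rw [eventually_inf_principal, eventually_atBot] at hev
    obtain ⟨m, hm⟩ := hev
    obtain ⟨a, haI, ha⟩ := not_bddBelow_iff.1 hI (min m c)
    exact ⟨a, haI, ha.le.trans (min_le_right _ _), hm a (ha.le.trans (min_le_left _ _)) haI⟩

theorem IsPathOn.exists_ge_dist_right_lt {X : Type*} [MetricSpace X] {γ : ℝ → X} {I : Set ℝ}
    {x y : X} (h : IsPathOn γ I x y) {c : ℝ} (hc : c ∈ I) {ε : ℝ} (hε : 0 < ε) :
    ∃ b ∈ I, c ≤ b ∧ dist (γ b) y < ε := by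
  have hev := h.2.2.2.2.eventually (Metric.ball_mem_nhds y hε)
  unfold rightEndFilter at hev
  split_ifs at hev with hI
  · rcases (le_csSup hI hc).eq_or_lt with heq | hlt
    · exact ⟨c, hc, le_rfl, (heq ▸ hev).self_of_nhdsWithin hc⟩
    · have : (𝓝[I] (sSup I)).NeBot :=
        mem_closure_iff_nhdsWithin_neBot.1 (csSup_mem_closure h.1 hI)
      obtain ⟨b, ⟨hb, hbI⟩, hcb⟩ := ((hev.and self_mem_nhdsWithin).and
        (mem_nhdsWithin_of_mem_nhds (Ioi_mem_nhds hlt))).exists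
      exact ⟨b, hbI, le_of_lt hcb, hb⟩
  · rw [eventually_inf_principal, eventually_atTop] at hev
    obtain ⟨m, hm⟩ := hev
    obtain ⟨b, hbI, hb⟩ := not_bddAbove_iff.1 hI (max m c)
    exact ⟨b, hbI, (le_max_right _ _).trans hb.le, hm b ((le_max_left _ _).trans hb.le) hbI⟩

/-- If the intrinsic distance is less than `C`, then there are `C`-Lipschitz curves on the unit
interval whose endpoints are arbitrarily close to the given points. -/
theorem exists_lipschitzOnWith_of_geodDist_lt {X : Type*} [MetricSpace X] {x y : X} {C : ℝ≥0}
    (hC : geodDist x y < C) {ε : ℝ} (hε : 0 < ε) :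
    ∃ g : ℝ → X, LipschitzOnWith C g (Icc 0 1) ∧ dist (g 0) x < ε ∧ dist (g 1) y < ε := by
  simp only [geodDist, iInf_lt_iff] at hC
  obtain ⟨γ, I, hγ, hlen⟩ := hC
  obtain ⟨c, hc⟩ := hγ.1
  obtain ⟨a, haI, hac, ha⟩ := hγ.exists_le_dist_left_lt hc hε
  obtain ⟨b, hbI, hcb, hb⟩ := hγ.exists_ge_dist_right_lt hc hε
  have hsub : Icc a b ⊆ I := hγ.2.1.out haI hbI
  obtain ⟨g, hg, hg0, hg1⟩ := (hγ.2.2.1.mono hsub).exists_lipschitzOnWith_reparametrization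
    (hac.trans hcb) ((eVariationOn.mono γ hsub).trans hlen.le)
  exact ⟨g, hg, hg0 ▸ ha, hg1 ▸ hb⟩

/-- Compactness of Lipschitz curves in a proper space: if the Lipschitz constants converge to `L`
and the endpoints converge to `x` and `y`, then some `L`-Lipschitz curve joins `x` to `y`. -/
theorem exists_lipschitzOnWith_of_tendsto {X : Type*} [MetricSpace X] [ProperSpace X] {x y : X}
    {g : ℕ → ℝ → X} {C : ℕ → ℝ≥0} {L : ℝ≥0} (hg : ∀ n, LipschitzOnWith (C n) (g n) (Icc 0 1))
    (hC : Tendsto C atTop (𝓝 L)) (hx : Tendsto (fun n => g n 0) atTop (𝓝 x))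
    (hy : Tendsto (fun n => g n 1) atTop (𝓝 y)) :
    ∃ γ : ℝ → X, LipschitzOnWith L γ (Icc 0 1) ∧ γ 0 = x ∧ γ 1 = y := by
  have h0 : (0 : ℝ) ∈ Icc (0 : ℝ) 1 := left_mem_Icc.2 zero_le_one
  have h1 : (1 : ℝ) ∈ Icc (0 : ℝ) 1 := right_mem_Icc.2 zero_le_one
  have hle : (hyperfilter ℕ : Filter ℕ) ≤ atTop := Nat.hyperfilter_le_atTop
  have hC' : Tendsto (fun n => (C n : ℝ)) (hyperfilter ℕ) (𝓝 L) :=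
    (NNReal.tendsto_coe.2 hC).mono_left hle
  have hlim : ∀ t ∈ Icc (0 : ℝ) 1, ∃ z, Tendsto (fun n => g n t) (hyperfilter ℕ) (𝓝 z) := by
    intro t ht
    have hmem : ∀ᶠ n in (hyperfilter ℕ : Filter ℕ),
        g n t ∈ Metric.closedBall x (L + 1 + 1) := by
      filter_upwards [hC'.eventually (gt_mem_nhds (lt_add_one (L : ℝ))),
        (hx.mono_left hle).eventually (Metric.ball_mem_nhds x one_pos)] with n hn hnx
      calc dist (g n t) x ≤ dist (g n t) (g n 0) + dist (g n 0) x := dist_triangle _ _ _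
        _ ≤ C n * dist t 0 + 1 := add_le_add ((hg n).dist_le_mul t ht 0 h0) (le_of_lt hnx)
        _ ≤ C n * 1 + 1 := by
          gcongr
          rw [Real.dist_0_eq_abs, abs_of_nonneg ht.1]
          exact ht.2
        _ ≤ L + 1 + 1 := by linarith
    obtain ⟨z, -, hz⟩ := (isCompact_closedBall x ((L : ℝ) + 1 + 1)).ultrafilter_le_nhds
      ((hyperfilter ℕ).map fun n => g n t) (le_principal_iff.2 hmem)
    exact ⟨z, hz⟩
  have : Nonempty X := ⟨x⟩
  choose! γ hγ using hlim
  refine ⟨γ, LipschitzOnWith.of_dist_le_mul fun s hs t ht => ?_,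
    tendsto_nhds_unique (hγ 0 h0) (hx.mono_left hle),
    tendsto_nhds_unique (hγ 1 h1) (hy.mono_left hle)⟩
  exact le_of_tendsto_of_tendsto' ((hγ s hs).dist (hγ t ht)) (hC'.mul_const _)
    fun n => (hg n).dist_le_mul s hs t ht

theorem ContinuousOn.isPathOn_Icc {X : Type*} [MetricSpace X] {γ : ℝ → X} {a b : ℝ}
    (hab : a ≤ b) (hc : ContinuousOn γ (Icc a b)) : IsPathOn γ (Icc a b) (γ a) (γ b) := by
  refine ⟨nonempty_Icc.2 hab, ordConnected_Icc, hc, ?_, ?_⟩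
  · rw [leftEndFilter, if_pos bddBelow_Icc, csInf_Icc hab]
    exact hc a (left_mem_Icc.2 hab)
  · rw [rightEndFilter, if_pos bddAbove_Icc, csSup_Icc hab]
    exact hc b (right_mem_Icc.2 hab)

/-- In a proper metric space, any two points at finite intrinsic (geodesic)
distance are joined by a minimizing geodesic, i.e. a curve `γ : [a⁻, a⁺] → X` with
`γ a⁻ = x⁻`, `γ a⁺ = x⁺` and `L_d(γ) = d_g(x⁻, x⁺)`. -/
theorem exists_minimizing_geodesic
    {X : Type*} [MetricSpace X] [ProperSpace X] (xm xp : X)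
    (hfin : geodDist xm xp ≠ ⊤) :
    ∃ (a b : ℝ) (γ : ℝ → X), a ≤ b ∧ ContinuousOn γ (Set.Icc a b) ∧
      γ a = xm ∧ γ b = xp ∧ eVariationOn γ (Set.Icc a b) = geodDist xm xp := by
  obtain ⟨L, hL⟩ : ∃ L : ℝ≥0, (L : ℝ≥0∞) = geodDist xm xp := ⟨_, ENNReal.coe_toNNReal hfin⟩
  set δ : ℕ → ℝ≥0 := fun n => 1 / ((n : ℝ≥0) + 1)
  have hδpos : ∀ n, 0 < δ n := fun n => by positivity
  have hδlim : Tendsto δ atTop (𝓝 0) := tendsto_one_div_add_atTop_nhds_zero_nat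
  have happrox : ∀ n, ∃ g : ℝ → X, LipschitzOnWith (L + δ n) g (Icc 0 1) ∧
      dist (g 0) xm < δ n ∧ dist (g 1) xp < δ n := fun n =>
    exists_lipschitzOnWith_of_geodDist_lt
      (by rw [← hL]; exact_mod_cast lt_add_of_pos_right L (hδpos n)) (hδpos n)
  choose g hg hgm hgp using happrox
  have hδlim' : Tendsto (fun n => (δ n : ℝ)) atTop (𝓝 0) := NNReal.tendsto_coe.2 hδlim
  obtain ⟨γ, hγ, hγm, hγp⟩ := exists_lipschitzOnWith_of_tendsto hg
    (by simpa using hδlim.const_add L)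
    (tendsto_iff_dist_tendsto_zero.2 <|
      squeeze_zero (fun _ => dist_nonneg) (fun n => (hgm n).le) hδlim')
    (tendsto_iff_dist_tendsto_zero.2 <|
      squeeze_zero (fun _ => dist_nonneg) (fun n => (hgp n).le) hδlim')
  rw [← hL]
  refine ⟨0, 1, γ, zero_le_one, hγ.continuousOn, hγm, hγp, le_antisymm ?_ ?_⟩
  · simpa [eVariationOn_id_Icc] using hγ.comp_eVariationOn_le (mapsTo_id (Icc (0 : ℝ) 1))
  · have hpath := hγ.continuousOn.isPathOn_Icc zero_le_one
    rw [hγm, hγp] at hpath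
    rw [hL]
    exact iInf₂_le_of_le γ (Icc 0 1) (iInf_le _ hpath)
end

section
/- Let (X,d) be a proper length metric space and K : X → [0,∞) a continuous weight function such that K(x₀) > 0 for some x₀ ∈ X. Then for each x ∈ X the map r ↦ K^r(x) := sup{ K(z) : d(x,z) ≤ r } is continuous on [0, +∞). -/
open Filter Topology MeasureTheory Set
open scoped ENNReal NNReal Classical

theorem frequently_leftEndFilter_le {I : Set ℝ} {t : ℝ} (ht : t ∈ I) :
    ∃ᶠ a in leftEndFilter I, a ∈ I ∧ a ≤ t := by
  unfold leftEndFilter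
  split_ifs with hI
  · rcases (csInf_le hI ht).eq_or_lt with h | h
    · rw [h]
      exact fun hne => (hne.self_of_nhdsWithin ht) ⟨ht, le_rfl⟩
    · have : (𝓝[I] (sInf I)).NeBot :=
        mem_closure_iff_nhdsWithin_neBot.1 (csInf_mem_closure ⟨t, ht⟩ hI)
      refine Eventually.frequently ?_
      filter_upwards [self_mem_nhdsWithin, nhdsWithin_le_nhds (Iio_mem_nhds h)] with a ha hat
      exact ⟨ha, le_of_lt hat⟩
  · rw [frequently_inf_principal]
    refine frequently_atBot.2 fun c => ?_
    obtain ⟨a, ha, hac⟩ := not_bddBelow_iff.1 hI (min c t)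
    exact ⟨a, hac.le.trans (min_le_left _ _), ha, ha, hac.le.trans (min_le_right _ _)⟩

theorem frequently_rightEndFilter_ge {I : Set ℝ} {t : ℝ} (ht : t ∈ I) :
    ∃ᶠ b in rightEndFilter I, b ∈ I ∧ t ≤ b := by
  unfold rightEndFilter
  split_ifs with hI
  · rcases (le_csSup hI ht).eq_or_lt with h | h
    · rw [← h]
      exact fun hne => (hne.self_of_nhdsWithin ht) ⟨ht, le_rfl⟩
    · have : (𝓝[I] (sSup I)).NeBot :=
        mem_closure_iff_nhdsWithin_neBot.1 (csSup_mem_closure ⟨t, ht⟩ hI)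
      refine Eventually.frequently ?_
      filter_upwards [self_mem_nhdsWithin, nhdsWithin_le_nhds (Ioi_mem_nhds h)] with a ha hat
      exact ⟨ha, le_of_lt hat⟩
  · rw [frequently_inf_principal]
    refine frequently_atTop.2 fun c => ?_
    obtain ⟨a, ha, hac⟩ := not_bddAbove_iff.1 hI (max c t)
    exact ⟨a, (le_max_left _ _).trans hac.le, ha, ha, (le_max_right _ _).trans hac.le⟩

section LengthSpace

variable {X : Type*} [MetricSpace X]

/-- The length of a path bounds the length of any inscribed two-edge polygon. -/
theorem IsPathOn.edist_add_edist_le_eVariationOn {γ : ℝ → X} {I : Set ℝ} {x y : X}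
    (h : IsPathOn γ I x y) {t : ℝ} (ht : t ∈ I) :
    edist x (γ t) + edist (γ t) y ≤ eVariationOn γ I := by
  obtain ⟨-, -, -, hx, hy⟩ := h
  have key : ∀ b ∈ I, t ≤ b →
      edist x (γ t) + edist (γ t) (γ b) ≤ eVariationOn γ I := by
    intro b hb htb
    have hlim : Tendsto (fun a => edist (γ a) (γ t) + edist (γ t) (γ b)) (leftEndFilter I)
        (𝓝 (edist x (γ t) + edist (γ t) (γ b))) :=
      (hx.edist tendsto_const_nhds).add tendsto_const_nhds
    refine le_of_tendsto_of_frequently hlim ((frequently_leftEndFilter_le ht).mono ?_)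
    rintro a ⟨ha, hat⟩
    calc edist (γ a) (γ t) + edist (γ t) (γ b)
        ≤ eVariationOn γ (I ∩ Icc a t) + eVariationOn γ (I ∩ Icc t b) := by
          gcongr
          · exact eVariationOn.edist_le γ ⟨ha, le_rfl, hat⟩ ⟨ht, hat, le_rfl⟩
          · exact eVariationOn.edist_le γ ⟨ht, le_rfl, htb⟩ ⟨hb, htb, le_rfl⟩
      _ = eVariationOn γ (I ∩ Icc a b) := eVariationOn.Icc_add_Icc γ hat htb ht
      _ ≤ eVariationOn γ I := eVariationOn.mono γ inter_subset_left
  have hlim : Tendsto (fun b => edist x (γ t) + edist (γ t) (γ b)) (rightEndFilter I)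
      (𝓝 (edist x (γ t) + edist (γ t) y)) :=
    tendsto_const_nhds.add (tendsto_const_nhds.edist hy)
  exact le_of_tendsto_of_frequently hlim
    ((frequently_rightEndFilter_ge ht).mono fun b hb => key b hb.1 hb.2)

/-- A path meets every sphere around its starting point that separates its endpoints. -/
theorem IsPathOn.exists_dist_eq {γ : ℝ → X} {I : Set ℝ} {x y : X}
    (h : IsPathOn γ I x y) {r : ℝ} (hr : 0 < r) (hry : r < dist x y) :
    ∃ t ∈ I, dist x (γ t) = r := by
  obtain ⟨⟨t, ht⟩, hI, hγ, hx, hy⟩ := h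
  have hx' : ∀ᶠ a in leftEndFilter I, dist x (γ a) < r :=
    (tendsto_const_nhds.dist hx).eventually_lt_const (by simpa using hr)
  have hy' : ∀ᶠ b in rightEndFilter I, r < dist x (γ b) :=
    (tendsto_const_nhds.dist hy).eventually_const_lt hry
  obtain ⟨a, ⟨ha, -⟩, har⟩ := ((frequently_leftEndFilter_le ht).and_eventually hx').exists
  obtain ⟨b, ⟨hb, -⟩, hbr⟩ := ((frequently_rightEndFilter_ge ht).and_eventually hy').exists
  exact hI.isPreconnected.intermediate_value ha hb
    ((continuous_const.dist continuous_id).comp_continuousOn hγ) ⟨har.le, hbr.le⟩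

/-- In a length space, points at distance less than `r + δ` from `x` are `δ`-close to the closed
ball of radius `r` around `x`. -/
theorem IsLengthSpace.exists_mem_closedBall_dist_lt (hlen : IsLengthSpace X) {x z : X} {r δ : ℝ}
    (hr : 0 ≤ r) (hδ : 0 < δ) (hz : dist x z < r + δ) :
    ∃ w ∈ Metric.closedBall x r, dist w z < δ := by
  rcases le_or_gt (dist x z) r with hzr | hzr
  · exact ⟨z, by rwa [Metric.mem_closedBall'], by simpa using hδ⟩
  rcases hr.eq_or_lt with rfl | hr
  · exact ⟨x, by simp, by simpa using hz⟩
  have hlt : geodDist x z < ENNReal.ofReal (r + δ) := by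
    rw [hlen x z, edist_dist]
    exact (ENNReal.ofReal_lt_ofReal_iff (by positivity)).2 hz
  simp only [geodDist, iInf_lt_iff] at hlt
  obtain ⟨γ, I, hγ, hvar⟩ := hlt
  obtain ⟨t, ht, htr⟩ := hγ.exists_dist_eq hr hzr
  refine ⟨γ t, by rw [Metric.mem_closedBall', htr], ?_⟩
  have := (hγ.edist_add_edist_le_eVariationOn ht).trans_lt hvar
  rw [edist_dist, edist_dist, ← ENNReal.ofReal_add dist_nonneg dist_nonneg,
    ENNReal.ofReal_lt_ofReal_iff (by positivity), htr] at this
  linarith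

theorem le_Ksup [ProperSpace X] {K : X → ℝ} (hK : Continuous K) {x z : X} {r : ℝ}
    (hz : z ∈ Metric.closedBall x r) : K z ≤ Ksup K x r :=
  le_csSup ((isCompact_closedBall x r).image hK).bddAbove (mem_image_of_mem K hz)

theorem Ksup_le {K : X → ℝ} {x : X} {r c : ℝ} (hr : 0 ≤ r)
    (h : ∀ z ∈ Metric.closedBall x r, K z ≤ c) : Ksup K x r ≤ c :=
  csSup_le ((Metric.nonempty_closedBall.2 hr).image K) (forall_mem_image.2 h)

end LengthSpace

/-- In a proper length space, for a continuous nonnegative weight `K` which is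
positive somewhere, the map `r ↦ K^r(x) = sup { K z : dist x z ≤ r }` is continuous on
`[0, ∞)`, for every `x`. -/
theorem Ksup_continuousOn
    {X : Type*} [MetricSpace X] [ProperSpace X] (hlen : IsLengthSpace X)
    (K : X → ℝ) (hKc : Continuous K) (hK0 : ∀ x, 0 ≤ K x)
    (hpos : ∃ x₀ : X, 0 < K x₀) :
    ∀ x : X, ContinuousOn (fun r => Ksup K x r) (Set.Ici 0) := by
  intro x r₀ hr₀
  rw [Metric.continuousWithinAt_iff]
  intro ε hε
  obtain ⟨δ, hδ, hKδ⟩ := Metric.uniformContinuousOn_iff.1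
    ((isCompact_closedBall x (r₀ + 1)).uniformContinuousOn_of_continuous hKc.continuousOn)
    (ε / 2) (half_pos hε)
  have hle : ∀ r s, 0 ≤ r → 0 ≤ s → r ≤ r₀ + 1 → s ≤ r₀ + 1 → |s - r| < δ →
      Ksup K x s ≤ Ksup K x r + ε / 2 := by
    intro r s hr hs hr1 hs1 hsr
    refine Ksup_le hs fun z hz => ?_
    obtain ⟨w, hw, hwz⟩ := hlen.exists_mem_closedBall_dist_lt (z := z) hr hδ
      (by linarith [Metric.mem_closedBall'.1 hz, (abs_lt.1 hsr).2])
    have hKwz := hKδ w (Metric.closedBall_subset_closedBall hr1 hw) z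
      (Metric.closedBall_subset_closedBall hs1 hz) hwz
    rw [Real.dist_eq] at hKwz
    linarith [(abs_lt.1 hKwz).1, le_Ksup hKc hw]
  refine ⟨min δ 1, lt_min hδ one_pos, fun r hr hrr₀ => ?_⟩
  rw [Real.dist_eq, lt_min_iff] at hrr₀
  have hr1 : r ≤ r₀ + 1 := by linarith [(abs_lt.1 hrr₀.2).2]
  have h₁ := hle r₀ r hr₀ hr (by linarith) hr1 hrr₀.1
  have h₂ := hle r r₀ hr hr₀ hr1 (by linarith) (by rw [abs_sub_comm]; exact hrr₀.1)
  rw [Real.dist_eq, abs_lt]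
  constructor <;> linarith
end
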